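/- arXiv:2305.12847 — 2 statements merged into one kernel-verified Lean document; each statement's English description precedes it below -/
import Mathlib

section
/- Let n ≥ 2, 0 < λ ≤ Λ, set M = 2√(n−1)(1 + 2√((n−1)Λ/λ)), let δ > 0, and let ε₀ > 0 satisfy 4 − (2+ε₀)(1+ε₀)(M−1)^{ε₀} > 0. Define ψ : ℝⁿ → ℝ by ψ(x) = δ + 4n(M + δ/(λM))(xₙ + δ) − n(M² + δ/λ)·xₙ(xₙ + δ) + (λ/(2Λ(n−1))) ∑_{i=1}^{n−1} ((M|xᵢ| − 1)⁺)^{2+ε₀}. Then ψ is twice continuously differentiable, and for every x ∈ ℝⁿ with |xᵢ| ≤ 1 for all 1 ≤ i ≤ n−1, one has (λ/n)·∂²ψ/∂xₙ²(x) + Λ·∑_{i=1}^{n−1} ∂²ψ/∂xᵢ²(x) ≤ −2δ. -/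
open Metric

noncomputable section

abbrev Eu (n : ℕ) := EuclideanSpace ℝ (Fin n)

/-- The last coordinate `xₙ` of a point `x ∈ ℝⁿ`. -/
def lastCoord {n : ℕ} (x : Eu n) : ℝ :=
  if h : 0 < n then x ⟨n - 1, Nat.sub_lt h Nat.one_pos⟩ else 0

/-- The barrier function
`ψ(x) = δ + 4n(M + δ/(λM))(xₙ + δ) − n(M² + δ/λ) xₙ(xₙ + δ)
        + (λ/(2Λ(n−1))) ∑_{i=1}^{n−1} ((M|xᵢ| − 1)⁺)^{2+ε₀}`. -/
def psi (n : ℕ) (lam Lam M δ ε₀ : ℝ) (x : Eu n) : ℝ :=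
  δ + 4 * n * (M + δ / (lam * M)) * (lastCoord x + δ)
    - n * (M ^ 2 + δ / lam) * lastCoord x * (lastCoord x + δ)
    + lam / (2 * Lam * ((n : ℝ) - 1)) *
        ∑ i ∈ Finset.univ.filter (fun i : Fin n => (i : ℕ) < n - 1),
          max (M * |x i| - 1) 0 ^ (2 + ε₀)


/-- The second partial derivative `∂²ψ/∂xᵢ∂xⱼ (x)`. -/
def secondPartial {n : ℕ} (ψ : Eu n → ℝ) (x : Eu n) (i j : Fin n) : ℝ :=
  iteratedFDeriv ℝ 2 ψ x ![EuclideanSpace.single i 1, EuclideanSpace.single j 1]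

lemma hasDerivAt_max_zero_rpow {p : ℝ} (hp : 1 < p) (t : ℝ) :
    HasDerivAt (fun s : ℝ => max s 0 ^ p) (p * max t 0 ^ (p - 1)) t := by
  rcases lt_trichotomy t 0 with ht | rfl | ht
  · rw [max_eq_right ht.le, Real.zero_rpow (by linarith), mul_zero]
    refine (hasDerivAt_const t (0 : ℝ)).congr_of_eventuallyEq ?_
    filter_upwards [eventually_lt_nhds ht] with s hs
    rw [max_eq_right hs.le, Real.zero_rpow (by linarith)]
  · rw [max_self, Real.zero_rpow (by linarith), mul_zero]
    have h := Real.hasDerivAt_rpow_const (x := 0) (p := p) (Or.inr hp.le)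
    rw [Real.zero_rpow (by linarith), mul_zero, hasDerivAt_iff_isLittleO] at h
    rw [hasDerivAt_iff_isLittleO]
    refine Asymptotics.IsBigO.trans_isLittleO (Asymptotics.IsBigO.of_bound 1 ?_) h
    filter_upwards with s
    rcases le_total s 0 with hs | hs
    · simp [max_eq_right hs, Real.zero_rpow (show p ≠ 0 by linarith)]
    · simp [max_eq_left hs]
  · rw [max_eq_left ht.le]
    refine (Real.hasDerivAt_rpow_const (Or.inl ht.ne')).congr_of_eventuallyEq ?_
    filter_upwards [eventually_gt_nhds ht] with s hs
    rw [max_eq_left hs.le]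

lemma max_mul_abs_sub_one_rpow {M p : ℝ} (hM : 0 ≤ M) (hp : 0 < p) (t : ℝ) :
    max (M * |t| - 1) 0 ^ p = max (M * t - 1) 0 ^ p + max (-M * t - 1) 0 ^ p := by
  rcases le_total 0 t with ht | ht
  · have h : -M * t - 1 ≤ 0 := by nlinarith
    rw [abs_of_nonneg ht, max_eq_right h, Real.zero_rpow hp.ne', add_zero]
  · have h : M * t - 1 ≤ 0 := by nlinarith
    rw [abs_of_nonpos ht, max_eq_right h, Real.zero_rpow hp.ne', zero_add]
    congr 2
    ring

lemma hasDerivAt_max_affine_rpow {p : ℝ} (hp : 1 < p) (a t : ℝ) :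
    HasDerivAt (fun s : ℝ => max (a * s - 1) 0 ^ p)
      (p * max (a * t - 1) 0 ^ (p - 1) * a) t := by
  have h : HasDerivAt (fun s : ℝ => a * s - 1) a t := by
    simpa using ((hasDerivAt_id t).const_mul a).sub_const 1
  exact (hasDerivAt_max_zero_rpow hp (a * t - 1)).comp t h

lemma hasDerivAt_max_abs_rpow {M p : ℝ} (hM : 0 ≤ M) (hp : 1 < p) (t : ℝ) :
    HasDerivAt (fun s : ℝ => max (M * |s| - 1) 0 ^ p)
      (p * M * (max (M * t - 1) 0 ^ (p - 1) - max (-M * t - 1) 0 ^ (p - 1))) t := by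
  simp_rw [max_mul_abs_sub_one_rpow hM (show 0 < p by linarith)]
  refine ((hasDerivAt_max_affine_rpow hp M t).add
    (hasDerivAt_max_affine_rpow hp (-M) t)).congr_deriv ?_
  ring

lemma hasDerivAt_max_abs_rpow_deriv {M p : ℝ} (hM : 0 ≤ M) (hp : 2 < p) (t : ℝ) :
    HasDerivAt
      (fun s : ℝ => p * M * (max (M * s - 1) 0 ^ (p - 1) - max (-M * s - 1) 0 ^ (p - 1)))
      (p * (p - 1) * M ^ 2 * max (M * |t| - 1) 0 ^ (p - 2)) t := by
  have hp' : 1 < p - 1 := by linarith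
  refine (((hasDerivAt_max_affine_rpow hp' M t).sub
    (hasDerivAt_max_affine_rpow hp' (-M) t)).const_mul (p * M)).congr_deriv ?_
  rw [max_mul_abs_sub_one_rpow hM (show 0 < p - 2 by linarith),
    show p - 1 - 1 = p - 2 by ring]
  ring

lemma contDiff_two_of_hasDerivAt {f f' f'' : ℝ → ℝ} (h : ∀ t, HasDerivAt f (f' t) t)
    (h' : ∀ t, HasDerivAt f' (f'' t) t) (hc : Continuous f'') : ContDiff ℝ 2 f := by
  have e : deriv f = f' := funext fun t => (h t).deriv
  have e' : deriv f' = f'' := funext fun t => (h' t).deriv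
  have h1 : ContDiff ℝ 1 f' := by
    rw [contDiff_one_iff_deriv, e']
    exact ⟨fun t => (h' t).differentiableAt, hc⟩
  rw [show (2 : WithTop ℕ∞) = 1 + 1 by norm_num, contDiff_succ_iff_deriv, e]
  exact ⟨fun t => (h t).differentiableAt, by simp, h1⟩

lemma hasLineDerivAt_separable {n : ℕ} {F F' : Fin n → ℝ → ℝ}
    (hF : ∀ j t, HasDerivAt (F j) (F' j t) t) (x : Eu n) (i : Fin n) :
    HasLineDerivAt ℝ (fun y : Eu n => ∑ j, F j (y j)) (F' i (x i)) x
      (EuclideanSpace.single i 1) := by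
  have h : ∀ j ∈ Finset.univ, HasDerivAt
      (fun t : ℝ => F j ((x + t • EuclideanSpace.single i (1 : ℝ) : Eu n) j))
      (F' j (x j) * (EuclideanSpace.single i (1 : ℝ) : Eu n) j) 0 := by
    intro j _
    have hl : HasDerivAt (fun t : ℝ => x j + t * (EuclideanSpace.single i (1 : ℝ) : Eu n) j)
        ((EuclideanSpace.single i (1 : ℝ) : Eu n) j) 0 := by
      simpa using ((hasDerivAt_id (0 : ℝ)).mul_const
        ((EuclideanSpace.single i (1 : ℝ) : Eu n) j)).const_add (x j)
    have hF0 : HasDerivAt (F j) (F' j (x j))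
        (x j + 0 * (EuclideanSpace.single i (1 : ℝ) : Eu n) j) := by
      simpa using hF j (x j)
    exact hF0.comp (0 : ℝ) hl
  have hs := HasDerivAt.fun_sum h
  simpa [HasLineDerivAt, Pi.single_apply] using hs

lemma secondPartial_eq {n : ℕ} {f g : Eu n → ℝ} {c : ℝ} (hf : ContDiff ℝ 2 f) {x : Eu n}
    {i : Fin n} (hg : ∀ y, HasLineDerivAt ℝ f (g y) y (EuclideanSpace.single i 1))
    (hc : HasLineDerivAt ℝ g c x (EuclideanSpace.single i 1)) :
    secondPartial f x i i = c := by
  have hd : Differentiable ℝ f := hf.differentiable (by norm_num)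
  have hd' : Differentiable ℝ (fderiv ℝ f) :=
    (hf.fderiv_right (m := 1) (by norm_num)).differentiable (by norm_num)
  have eg : g = fun y => fderiv ℝ f y (EuclideanSpace.single i 1) := by
    funext y
    rw [← (hd y).lineDeriv_eq_fderiv, (hg y).lineDeriv]
  have h2 : HasFDerivAt g ((fderiv ℝ (fderiv ℝ f) x).flip (EuclideanSpace.single i 1)) x := by
    rw [eg]
    refine ((hd' x).hasFDerivAt.clm_apply
      (hasFDerivAt_const (EuclideanSpace.single i (1 : ℝ) : Eu n) x)).congr_fderiv ?_
    ext v
    simp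
  rw [secondPartial, iteratedFDeriv_two_apply, ← hc.lineDeriv,
    (h2.hasLineDerivAt _).lineDeriv]
  simp

/-- The one-variable summands of which `psi` is the sum. -/
def psiCoord (n : ℕ) (lam Lam M δ ε₀ : ℝ) (i : Fin n) (t : ℝ) : ℝ :=
  if (i : ℕ) < n - 1 then lam / (2 * Lam * ((n : ℝ) - 1)) * max (M * |t| - 1) 0 ^ (2 + ε₀)
  else δ + 4 * n * (M + δ / (lam * M)) * (t + δ) - n * (M ^ 2 + δ / lam) * t * (t + δ)

/-- The derivative of `psiCoord`. -/
def psiCoordDeriv (n : ℕ) (lam Lam M δ ε₀ : ℝ) (i : Fin n) (t : ℝ) : ℝ :=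
  if (i : ℕ) < n - 1 then lam / (2 * Lam * ((n : ℝ) - 1)) *
    ((2 + ε₀) * M *
      (max (M * t - 1) 0 ^ (2 + ε₀ - 1) - max (-M * t - 1) 0 ^ (2 + ε₀ - 1)))
  else 4 * n * (M + δ / (lam * M)) - n * (M ^ 2 + δ / lam) * (2 * t + δ)

/-- The second derivative of `psiCoord`. -/
def psiCoordDeriv2 (n : ℕ) (lam Lam M δ ε₀ : ℝ) (i : Fin n) (t : ℝ) : ℝ :=
  if (i : ℕ) < n - 1 then lam / (2 * Lam * ((n : ℝ) - 1)) *
    ((2 + ε₀) * (2 + ε₀ - 1) * M ^ 2 * max (M * |t| - 1) 0 ^ (2 + ε₀ - 2))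
  else -(2 * n * (M ^ 2 + δ / lam))

lemma psi_eq_sum_psiCoord {n : ℕ} (hn : 0 < n) (lam Lam M δ ε₀ : ℝ) :
    psi n lam Lam M δ ε₀ = fun x => ∑ i, psiCoord n lam Lam M δ ε₀ i (x i) := by
  funext x
  have h : Finset.univ.filter (fun i : Fin n => ¬ (i : ℕ) < n - 1) = {⟨n - 1, by omega⟩} := by
    ext i
    simp only [Finset.mem_filter, Finset.mem_univ, true_and, Finset.mem_singleton, Fin.ext_iff]
    omega
  simp only [psiCoord, Finset.sum_ite, h, Finset.sum_singleton, psi, lastCoord, dif_pos hn,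
    Finset.mul_sum]
  ring

lemma hasDerivAt_psiCoord {n : ℕ} {lam Lam M δ ε₀ : ℝ} (hM : 0 ≤ M) (hε₀ : 0 < ε₀)
    (i : Fin n) (t : ℝ) :
    HasDerivAt (psiCoord n lam Lam M δ ε₀ i) (psiCoordDeriv n lam Lam M δ ε₀ i t) t := by
  unfold psiCoord psiCoordDeriv
  split_ifs
  · exact (hasDerivAt_max_abs_rpow hM (by linarith) t).const_mul _
  · have h1 := ((hasDerivAt_id t).add_const δ).const_mul (4 * n * (M + δ / (lam * M)))
    have h2 := ((hasDerivAt_id t).const_mul (n * (M ^ 2 + δ / lam))).mul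
      ((hasDerivAt_id t).add_const δ)
    refine ((h1.const_add δ).sub h2).congr_deriv ?_
    simp only [id]
    ring

lemma hasDerivAt_psiCoordDeriv {n : ℕ} {lam Lam M δ ε₀ : ℝ} (hM : 0 ≤ M) (hε₀ : 0 < ε₀)
    (i : Fin n) (t : ℝ) :
    HasDerivAt (psiCoordDeriv n lam Lam M δ ε₀ i) (psiCoordDeriv2 n lam Lam M δ ε₀ i t) t := by
  unfold psiCoordDeriv psiCoordDeriv2
  split_ifs
  · exact (hasDerivAt_max_abs_rpow_deriv hM (by linarith) t).const_mul _
  · have h := (((hasDerivAt_id t).const_mul 2).add_const δ).const_mul (n * (M ^ 2 + δ / lam))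
    refine (h.const_sub (4 * n * (M + δ / (lam * M)))).congr_deriv ?_
    ring

lemma continuous_psiCoordDeriv2 {n : ℕ} {lam Lam M δ ε₀ : ℝ} (hε₀ : 0 < ε₀) (i : Fin n) :
    Continuous (psiCoordDeriv2 n lam Lam M δ ε₀ i) := by
  unfold psiCoordDeriv2
  split_ifs
  · have h : Continuous fun t : ℝ => max (M * |t| - 1) 0 ^ (2 + ε₀ - 2) :=
      Continuous.rpow_const (by fun_prop) fun t => Or.inr (by linarith)
    fun_prop
  · exact continuous_const

lemma contDiff_psi {n : ℕ} {lam Lam M δ ε₀ : ℝ} (hn : 0 < n) (hM : 0 ≤ M) (hε₀ : 0 < ε₀) :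
    ContDiff ℝ 2 (psi n lam Lam M δ ε₀) := by
  rw [psi_eq_sum_psiCoord hn]
  refine ContDiff.sum fun i _ => ?_
  have h := contDiff_two_of_hasDerivAt
    (hasDerivAt_psiCoord (n := n) (lam := lam) (Lam := Lam) (δ := δ) hM hε₀ i)
    (hasDerivAt_psiCoordDeriv hM hε₀ i) (continuous_psiCoordDeriv2 hε₀ i)
  exact h.comp (by fun_prop)

lemma secondPartial_psi {n : ℕ} {lam Lam M δ ε₀ : ℝ} (hn : 0 < n) (hM : 0 ≤ M)
    (hε₀ : 0 < ε₀) (x : Eu n) (i : Fin n) :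
    secondPartial (psi n lam Lam M δ ε₀) x i i = psiCoordDeriv2 n lam Lam M δ ε₀ i (x i) := by
  refine secondPartial_eq (g := fun y => psiCoordDeriv n lam Lam M δ ε₀ i (y i))
    (contDiff_psi hn hM hε₀) (fun y => ?_) ?_
  · rw [psi_eq_sum_psiCoord hn]
    exact hasLineDerivAt_separable (hasDerivAt_psiCoord hM hε₀) y i
  · have h : ∀ j t, HasDerivAt
        (fun s : ℝ => if j = i then psiCoordDeriv n lam Lam M δ ε₀ i s else 0)
        (if j = i then psiCoordDeriv2 n lam Lam M δ ε₀ i t else 0) t := by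
      intro j t
      split_ifs
      · exact hasDerivAt_psiCoordDeriv hM hε₀ i t
      · exact hasDerivAt_const t 0
    simpa using hasLineDerivAt_separable h x i

lemma two_le_two_mul_sqrt_mul {a b : ℝ} (ha : 1 ≤ a) :
    2 ≤ 2 * Real.sqrt a * (1 + 2 * Real.sqrt b) := by
  have h1 : 1 ≤ Real.sqrt a := Real.one_le_sqrt.mpr ha
  have h2 := Real.sqrt_nonneg b
  nlinarith


/-- the barrier `ψ` is `C²` and satisfies
`(λ/n) ∂²ψ/∂xₙ² + Λ ∑_{i<n} ∂²ψ/∂xᵢ² ≤ −2δ` whenever `|xᵢ| ≤ 1` for `i = 1, …, n−1`. -/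
theorem stmt9 (n : ℕ) (hn : 2 ≤ n) (lam Lam : ℝ) (hlam : 0 < lam) (hLam : lam ≤ Lam)
    (M : ℝ)
    (hM : M = 2 * Real.sqrt ((n : ℝ) - 1) *
      (1 + 2 * Real.sqrt (((n : ℝ) - 1) * Lam / lam)))
    (δ : ℝ) (hδ : 0 < δ) (ε₀ : ℝ) (hε₀ : 0 < ε₀)
    (hε : 4 - (2 + ε₀) * (1 + ε₀) * (M - 1) ^ ε₀ > 0) :
    ContDiff ℝ 2 (psi n lam Lam M δ ε₀) ∧
    ∀ x : Eu n, (∀ i : Fin n, (i : ℕ) < n - 1 → |x i| ≤ 1) →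
      lam / n * secondPartial (psi n lam Lam M δ ε₀) x ⟨n - 1, by omega⟩ ⟨n - 1, by omega⟩
        + Lam * ∑ i ∈ Finset.univ.filter (fun i : Fin n => (i : ℕ) < n - 1),
            secondPartial (psi n lam Lam M δ ε₀) x i i
      ≤ -(2 * δ) := by
  have hn1 : (1 : ℝ) ≤ (n : ℝ) - 1 := by
    have : (2 : ℝ) ≤ n := by exact_mod_cast hn
    linarith
  have hM2 : 2 ≤ M := hM ▸ two_le_two_mul_sqrt_mul hn1
  have hM0 : 0 ≤ M := by linarith
  have hn0 : 0 < n := by omega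
  have hL0 : 0 < Lam := hlam.trans_le hLam
  refine ⟨contDiff_psi hn0 hM0 hε₀, fun x hx => ?_⟩
  simp only [secondPartial_psi hn0 hM0 hε₀]
  have hlast : lam / n * psiCoordDeriv2 n lam Lam M δ ε₀ ⟨n - 1, by omega⟩
      (x ⟨n - 1, by omega⟩) = -(2 * lam * M ^ 2) - 2 * δ := by
    simp only [psiCoordDeriv2, lt_irrefl, if_false]
    field_simp
    ring
  have hterm : ∀ i ∈ Finset.univ.filter (fun i : Fin n => (i : ℕ) < n - 1),
      psiCoordDeriv2 n lam Lam M δ ε₀ i (x i) ≤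
        lam / (2 * Lam * ((n : ℝ) - 1)) * (4 * M ^ 2) := by
    intro i hi
    have hi' : (i : ℕ) < n - 1 := (Finset.mem_filter.mp hi).2
    have hmax : max (M * |x i| - 1) 0 ≤ M - 1 :=
      max_le (by nlinarith [hx i hi']) (by linarith)
    have hpow : max (M * |x i| - 1) 0 ^ ε₀ ≤ (M - 1) ^ ε₀ :=
      Real.rpow_le_rpow (le_max_right _ _) hmax hε₀.le
    rw [psiCoordDeriv2, if_pos hi', show 2 + ε₀ - 2 = ε₀ by ring,
      show 2 + ε₀ - 1 = 1 + ε₀ by ring]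
    refine mul_le_mul_of_nonneg_left ?_ (by positivity)
    calc (2 + ε₀) * (1 + ε₀) * M ^ 2 * max (M * |x i| - 1) 0 ^ ε₀
        ≤ (2 + ε₀) * (1 + ε₀) * M ^ 2 * (M - 1) ^ ε₀ := by gcongr
      _ = (2 + ε₀) * (1 + ε₀) * (M - 1) ^ ε₀ * M ^ 2 := by ring
      _ ≤ 4 * M ^ 2 := by gcongr; linarith
  have hcard : ((Finset.univ.filter (fun i : Fin n => (i : ℕ) < n - 1)).card : ℝ) =
      (n : ℝ) - 1 := by
    rw [Fin.card_filter_val_lt, min_eq_right (by omega), Nat.cast_sub (by omega), Nat.cast_one]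
  have hsum := Finset.sum_le_card_nsmul _ _ _ hterm
  rw [nsmul_eq_mul, hcard] at hsum
  have hbound : Lam * (((n : ℝ) - 1) * (lam / (2 * Lam * ((n : ℝ) - 1)) * (4 * M ^ 2))) =
      2 * lam * M ^ 2 := by
    have : (n : ℝ) - 1 ≠ 0 := by linarith
    field_simp
    ring
  have := mul_le_mul_of_nonneg_left hsum hL0.le
  rw [hlast]
  linarith


end
end

section
/- Let n ≥ 2, 0 < λ ≤ Λ, M = 2√(n−1)(1 + 2√((n−1)Λ/λ)), let ε₀ > 0, and let 0 < δ ≤ min(1,λ)/M. Define ψ : ℝⁿ → ℝ by ψ(x) = δ + 4n(M + δ/(λM))(xₙ + δ) − n(M² + δ/λ)·xₙ(xₙ + δ) + (λ/(2Λ(n−1))) ∑_{i=1}^{n−1} ((M|xᵢ| − 1)⁺)^{2+ε₀}. Then for every x ∈ ℝⁿ with |xᵢ| ≤ 1 for all 1 ≤ i ≤ n−1 and −δ ≤ xₙ ≤ 1/M, the gradient of ψ satisfies |Dψ(x)| ≤ (λ M (2+ε₀)/(2Λ))·(M−1)^{1+ε₀} + 16 n M. -/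
open Metric

noncomputable section

/-- The positive part raised to a power `p > 1` is differentiable everywhere. -/
lemma hasDerivAt_posPart_rpow {p : ℝ} (hp : 1 < p) (s : ℝ) :
    HasDerivAt (fun s : ℝ => max s 0 ^ p) (p * max s 0 ^ (p - 1)) s := by
  rcases lt_trichotomy s 0 with hs | rfl | hs
  · have h0 : p * max s 0 ^ (p - 1) = 0 := by
      rw [max_eq_right hs.le, Real.zero_rpow (by linarith), mul_zero]
    rw [h0]
    refine (hasDerivAt_const s (0 : ℝ)).congr_of_eventuallyEq ?_
    filter_upwards [eventually_lt_nhds hs] with t ht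
    rw [max_eq_right ht.le, Real.zero_rpow (by linarith)]
  · have h0 : p * max (0 : ℝ) 0 ^ (p - 1) = 0 := by
      rw [max_self, Real.zero_rpow (by linarith), mul_zero]
    rw [h0, ← hasDerivWithinAt_univ, ← Set.Iic_union_Ici (a := (0 : ℝ))]
    refine HasDerivWithinAt.union ?_ ?_
    · refine (hasDerivWithinAt_const (0 : ℝ) (Set.Iic 0) (0 : ℝ)).congr_of_mem
        (fun t ht => ?_) (by simp)
      rw [max_eq_right ht, Real.zero_rpow (by linarith)]
    · have h1 := (Real.hasDerivAt_rpow_const (x := 0) (p := p) (Or.inr hp.le)).hasDerivWithinAt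
        (s := Set.Ici 0)
      rw [Real.zero_rpow (by linarith), mul_zero] at h1
      refine h1.congr_of_mem (fun t ht => ?_) (by simp)
      rw [max_eq_left ht]
  · rw [max_eq_left hs.le]
    refine (Real.hasDerivAt_rpow_const (Or.inl hs.ne')).congr_of_eventuallyEq ?_
    filter_upwards [eventually_gt_nhds hs] with t ht
    rw [max_eq_left ht.le]

/-- The profile `((M|t| - 1)⁺)^p` is differentiable on `[-1, 1]`, with an explicit bound on the
derivative. -/
lemma exists_hasDerivAt_profile {p M t : ℝ} (hp : 1 < p) (hM : 1 ≤ M) (ht : |t| ≤ 1) :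
    ∃ d : ℝ, |d| ≤ p * M * (M - 1) ^ (p - 1) ∧
      HasDerivAt (fun t : ℝ => max (M * |t| - 1) 0 ^ p) d t := by
  have hB : 0 ≤ (M - 1) ^ (p - 1) := Real.rpow_nonneg (by linarith) _
  rcases eq_or_ne t 0 with rfl | h0
  · refine ⟨0, by rw [abs_zero]; positivity, ?_⟩
    refine (hasDerivAt_const (0 : ℝ) (0 : ℝ)).congr_of_eventuallyEq ?_
    have hc : ContinuousAt (fun t : ℝ => M * |t| - 1) 0 := by fun_prop
    filter_upwards [hc.eventually_lt_const (u := 0) (by simp)] with t ht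
    rw [max_eq_right ht.le, Real.zero_rpow (by linarith)]
  · refine ⟨_, ?_, HasDerivAt.comp t (h₂ := fun s : ℝ => max s 0 ^ p)
      (h := fun t : ℝ => M * |t| - 1) (hasDerivAt_posPart_rpow hp _)
      (((hasDerivAt_abs h0).const_mul M).sub_const 1)⟩
    have hsgn : |((SignType.sign t : SignType) : ℝ)| = 1 := by
      rcases lt_or_gt_of_ne h0 with h | h <;> simp [h]
    have hm : max (M * |t| - 1) 0 ≤ M - 1 :=
      max_le (by nlinarith) (by linarith)
    have hpow := Real.rpow_le_rpow (le_max_right _ _) hm (show 0 ≤ p - 1 by linarith)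
    have hpos : 0 ≤ max (M * |t| - 1) 0 ^ (p - 1) := Real.rpow_nonneg (le_max_right _ _) _
    rw [abs_mul, abs_mul, abs_mul, hsgn, abs_of_nonneg hpos, abs_of_pos (show 0 < M by linarith),
      abs_of_pos (show 0 < p by linarith)]
    calc p * max (M * |t| - 1) 0 ^ (p - 1) * (M * 1)
        = p * M * max (M * |t| - 1) 0 ^ (p - 1) := by ring
      _ ≤ p * M * (M - 1) ^ (p - 1) := by gcongr

lemma norm_euclideanProj_le {n : ℕ} (i : Fin n) :
    ‖(EuclideanSpace.proj i : Eu n →L[ℝ] ℝ)‖ ≤ 1 :=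
  ContinuousLinearMap.opNorm_le_bound _ zero_le_one fun x => by
    simpa using PiLp.norm_apply_le x i

/-- Bound for the derivative of `ψ` in the last coordinate. -/
lemma abs_normal_deriv_le {N M lam δ t : ℝ} (hN : 0 ≤ N) (hM : 1 ≤ M) (hlam : 0 < lam)
    (hδ : 0 < δ) (hδM : δ ≤ min 1 lam / M) (h₁ : -δ ≤ t) (h₂ : t ≤ 1 / M) :
    |4 * N * (M + δ / (lam * M)) - N * (M ^ 2 + δ / lam) * (2 * t + δ)| ≤ 16 * N * M := by
  have hM0 : 0 < M := by linarith
  rw [le_div_iff₀ hM0] at hδM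
  rw [le_div_iff₀ hM0] at h₂
  have hd1 : δ * M ≤ 1 := hδM.trans (min_le_left _ _)
  have hdl : δ * M ≤ lam := hδM.trans (min_le_right _ _)
  have hq0 : 0 < δ / (lam * M) := by positivity
  have hq : δ / (lam * M) ≤ 1 := by
    rw [div_le_one (by positivity)]
    nlinarith
  have heq : 4 * N * (M + δ / (lam * M)) - N * (M ^ 2 + δ / lam) * (2 * t + δ)
      = N * (M + δ / (lam * M)) * (4 - M * (2 * t + δ)) := by
    field_simp
  have hk : |4 - M * (2 * t + δ)| ≤ 5 := by
    rw [abs_le]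
    constructor <;> nlinarith
  rw [heq, abs_mul, abs_of_nonneg (by positivity)]
  calc N * (M + δ / (lam * M)) * |4 - M * (2 * t + δ)| ≤ N * (M + M) * 5 := by
        gcongr
        linarith
    _ ≤ 16 * N * M := by nlinarith [mul_nonneg hN hM0.le]

/-- gradient bound for the barrier `ψ` in the region
`{|xᵢ| ≤ 1 (i < n), −δ ≤ xₙ ≤ 1/M}`:
`|Dψ| ≤ (λM(2+ε₀)/(2Λ))(M−1)^{1+ε₀} + 16nM`. -/
theorem stmt10 (n : ℕ) (hn : 2 ≤ n) (lam Lam : ℝ) (hlam : 0 < lam) (hLam : lam ≤ Lam)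
    (M : ℝ)
    (hM : M = 2 * Real.sqrt ((n : ℝ) - 1) *
      (1 + 2 * Real.sqrt (((n : ℝ) - 1) * Lam / lam)))
    (ε₀ : ℝ) (hε₀ : 0 < ε₀) (δ : ℝ) (hδ : 0 < δ) (hδM : δ ≤ min 1 lam / M)
    (x : Eu n) (hx' : ∀ i : Fin n, (i : ℕ) < n - 1 → |x i| ≤ 1)
    (hxn₁ : -δ ≤ lastCoord x) (hxn₂ : lastCoord x ≤ 1 / M) :
    ‖gradient (psi n lam Lam M δ ε₀) x‖ ≤
      lam * M * (2 + ε₀) / (2 * Lam) * (M - 1) ^ (1 + ε₀) + 16 * n * M := by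
  have hn1 : (1 : ℝ) ≤ (n : ℝ) - 1 := by
    have : (2 : ℝ) ≤ n := by exact_mod_cast hn
    linarith
  have hLam0 : 0 < Lam := hlam.trans_le hLam
  have hM1 : 1 ≤ M := by
    have h1 : 1 ≤ Real.sqrt ((n : ℝ) - 1) := Real.one_le_sqrt.mpr hn1
    have h2 : 0 ≤ Real.sqrt (((n : ℝ) - 1) * Lam / lam) := Real.sqrt_nonneg _
    rw [hM]
    nlinarith
  have hnpos : 0 < n := by omega
  set l : Fin n := ⟨n - 1, Nat.sub_lt hnpos Nat.one_pos⟩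
  have hlast : ∀ y : Eu n, lastCoord y = y l := fun y => dif_pos hnpos
  set S := Finset.univ.filter (fun i : Fin n => (i : ℕ) < n - 1)
  have hcard : (S.card : ℝ) = (n : ℝ) - 1 := by
    have : S.card = n - 1 := by
      simp only [S, Fin.card_filter_val_lt]
      omega
    rw [this, Nat.cast_sub (by omega), Nat.cast_one]
  have hprof : ∀ i : Fin n, ∃ d : ℝ, i ∈ S →
      |d| ≤ (2 + ε₀) * M * (M - 1) ^ (1 + ε₀) ∧
        HasDerivAt (fun t : ℝ => max (M * |t| - 1) 0 ^ (2 + ε₀)) d (x i) := by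
    intro i
    by_cases hi : i ∈ S
    · obtain ⟨d, hd, hd'⟩ := exists_hasDerivAt_profile (p := 2 + ε₀) (by linarith) hM1
        (hx' i (Finset.mem_filter.mp hi).2)
      rw [show 2 + ε₀ - 1 = 1 + ε₀ by ring] at hd
      exact ⟨d, fun _ => ⟨hd, hd'⟩⟩
    · exact ⟨0, fun h => absurd h hi⟩
  choose d hd using hprof
  let P : Fin n → Eu n →L[ℝ] ℝ := fun i => EuclideanSpace.proj i
  have hP : ∀ i, HasFDerivAt (fun y : Eu n => y i) (P i) x := fun i => (P i).hasFDerivAt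
  have hnormal : HasDerivAt (fun t : ℝ => δ + 4 * n * (M + δ / (lam * M)) * (t + δ)
      - n * (M ^ 2 + δ / lam) * t * (t + δ))
      (4 * n * (M + δ / (lam * M)) - n * (M ^ 2 + δ / lam) * (2 * x l + δ)) (x l) := by
    have hid := hasDerivAt_id' (x l)
    refine ((((hid.add_const δ).const_mul (4 * n * (M + δ / (lam * M)))).const_add δ).sub
      ((hid.const_mul (n * (M ^ 2 + δ / lam))).mul (hid.add_const δ))).congr_deriv ?_
    ring
  set a := 4 * n * (M + δ / (lam * M)) - n * (M ^ 2 + δ / lam) * (2 * x l + δ)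
  set c := lam / (2 * Lam * ((n : ℝ) - 1)) with hc
  have hc0 : 0 ≤ c := by positivity
  have hfd : HasFDerivAt (psi n lam Lam M δ ε₀) (a • P l + c • ∑ i ∈ S, d i • P i) x := by
    have hsum : HasFDerivAt (fun y : Eu n => ∑ i ∈ S, max (M * |y i| - 1) 0 ^ (2 + ε₀))
        (∑ i ∈ S, d i • P i) x :=
      HasFDerivAt.fun_sum fun i hi => HasDerivAt.comp_hasFDerivAt
        (h₂ := fun t : ℝ => max (M * |t| - 1) 0 ^ (2 + ε₀)) x (hd i hi).2 (hP i)
    refine ((hnormal.comp_hasFDerivAt x (hP l)).add (hsum.const_mul c)).congr_of_eventuallyEq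
      (Filter.Eventually.of_forall fun y => ?_)
    simp [psi, hlast, S, c]
  have hgrad : ‖gradient (psi n lam Lam M δ ε₀) x‖ = ‖a • P l + c • ∑ i ∈ S, d i • P i‖ := by
    rw [gradient, hfd.fderiv, LinearIsometryEquiv.norm_map]
  have hterm : ∀ (b : ℝ) (i : Fin n), ‖b • P i‖ ≤ |b| := fun b i => by
    rw [norm_smul, Real.norm_eq_abs]
    exact mul_le_of_le_one_right (abs_nonneg b) (norm_euclideanProj_le i)
  rw [hlast] at hxn₁ hxn₂
  have ha : |a| ≤ 16 * n * M :=
    abs_normal_deriv_le (Nat.cast_nonneg n) hM1 hlam hδ hδM hxn₁ hxn₂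
  have hsumle : ‖∑ i ∈ S, d i • P i‖ ≤
      ((n : ℝ) - 1) * ((2 + ε₀) * M * (M - 1) ^ (1 + ε₀)) := by
    rw [← hcard, ← nsmul_eq_mul]
    exact (norm_sum_le _ _).trans
      (Finset.sum_le_card_nsmul _ _ _ fun i hi => (hterm _ i).trans (hd i hi).1)
  have htan : ‖c • ∑ i ∈ S, d i • P i‖ ≤
      lam * M * (2 + ε₀) / (2 * Lam) * (M - 1) ^ (1 + ε₀) := by
    rw [norm_smul, Real.norm_of_nonneg hc0]
    refine (mul_le_mul_of_nonneg_left hsumle hc0).trans_eq ?_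
    have : (n : ℝ) - 1 ≠ 0 := by linarith
    rw [hc]
    field_simp
  rw [hgrad]
  linarith [norm_add_le (a • P l) (c • ∑ i ∈ S, d i • P i), hterm a l]

end
end
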